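/- Let A be an M × n complex matrix and let r ≤ min(M, n). Let ∅ = S₀ ⊂ S₁ ⊂ ⋯ ⊂ S_r be a chain of sets of row indices with |S_k| = k, chosen greedily to maximize the volume at each step: for each k < r, S_{k+1} = S_k ∪ {i_{k+1}} with i_{k+1} ∉ S_k, and for every j ∉ S_k one has det(A_{S_k∪{i_{k+1}}} (A_{S_k∪{i_{k+1}}})ᴴ) ≥ det(A_{S_k∪{j}} (A_{S_k∪{j}})ᴴ). Then the final set S_r satisfies: for every set T of row indices with |T| = r, det(A_T (A_T)ᴴ) ≤ (r!)² · det(A_{S_r} (A_{S_r})ᴴ); i.e., the greedy submatrix has volume at most r! times smaller than the maximum volume among all r × n row submatrices. -/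

import Mathlib

open Matrix BigOperators

/-- The submatrix of `A` consisting of the rows indexed by the finite set `S`. -/
def rowsSub {M n : ℕ} (A : Matrix (Fin M) (Fin n) ℂ) (S : Finset (Fin M)) :
    Matrix {x // x ∈ S} (Fin n) ℂ :=
  A.submatrix (fun x : {x // x ∈ S} => (x : Fin M)) id

/-- The squared volume `det(B Bᴴ)` (a nonnegative real) of the row submatrix `A_S`. -/
noncomputable def sqVol {M n : ℕ} (A : Matrix (Fin M) (Fin n) ℂ) (S : Finset (Fin M)) : ℝ :=
  ((rowsSub A S * (rowsSub A S)ᴴ).det).re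

section Projection

variable {𝕜 E : Type*} [RCLike 𝕜] [NormedAddCommGroup E] [InnerProductSpace 𝕜 E]
  [FiniteDimensional 𝕜 E]

open Submodule

theorem norm_orthogonal_starProjection_add_sq {K U : Submodule 𝕜 E} (hKU : K ≤ U) {e x : E}
    (he : e ∈ Uᗮ) (hx : x ∈ U) :
    ‖Kᗮ.starProjection (e + x)‖ ^ 2 = ‖e‖ ^ 2 + ‖Kᗮ.starProjection x‖ ^ 2 := by
  have hxU : Kᗮ.starProjection x ∈ U := by
    rw [starProjection_orthogonal_val]
    exact U.sub_mem hx (hKU (K.starProjection_apply_mem x))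
  have h := norm_add_sq_eq_norm_sq_add_norm_sq_of_inner_eq_zero (𝕜 := 𝕜) e
    (Kᗮ.starProjection x) (U.inner_left_of_mem_orthogonal hxU he)
  rw [map_add, starProjection_eq_self_iff.2 (orthogonal_le hKU he)]
  simpa only [sq] using h

theorem norm_orthogonal_starProjection_anti {K U : Submodule 𝕜 E} (hKU : K ≤ U) (x : E) :
    ‖Uᗮ.starProjection x‖ ≤ ‖Kᗮ.starProjection x‖ := by
  have h : Uᗮ.starProjection x = Uᗮ.starProjection (Kᗮ.starProjection x) := by
    rw [starProjection_orthogonal_val (K := K), map_sub,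
      starProjection_orthogonal_apply_eq_zero (hKU (K.starProjection_apply_mem x)), sub_zero]
  rw [h]
  exact norm_starProjection_apply_le _ _

/-- If `p` is at least as far from `W` as each of the vectors `v i`, `i ∈ T`, then for some `i ∈ T`
replacing `v i` by `p` shrinks the distance to the span of `W` and the remaining vectors by a
factor of at most `T.card`. -/
theorem exists_norm_orthogonal_starProjection_le {ι : Type*} [DecidableEq ι] (W : Submodule 𝕜 E)
    {T : Finset ι} (hT : T.Nonempty) (v : ι → E) (p : E)
    (hp : ∀ i ∈ T, ‖Wᗮ.starProjection (v i)‖ ≤ ‖Wᗮ.starProjection p‖) :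
    ∃ i ∈ T, ‖(W ⊔ span 𝕜 (v '' (T.erase i)))ᗮ.starProjection (v i)‖ ≤
      T.card * ‖(W ⊔ span 𝕜 (v '' (T.erase i)))ᗮ.starProjection p‖ := by
  by_contra! hlt
  set R : ι → Submodule 𝕜 E := fun i => W ⊔ span 𝕜 (v '' (T.erase i)) with hR
  set U : Submodule 𝕜 E := W ⊔ span 𝕜 (v '' T) with hU
  have hRU (i : ι) : R i ≤ U :=
    sup_le_sup_left (span_mono (Set.image_mono (by simp))) _
  have hvU : ∀ i ∈ T, v i ∈ U := fun i hi =>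
    mem_sup_right (subset_span ⟨i, hi, rfl⟩)
  set e := Uᗮ.starProjection p
  have he : e ∈ Uᗮ := starProjection_apply_mem _ _
  obtain ⟨w, hw, y, hy, hwy⟩ := mem_sup.1 (U.starProjection_apply_mem p)
  obtain ⟨a, rfl⟩ := (mem_span_image_finset_iff_exists_fun' 𝕜).1 hy
  have hdecomp : p = e + (w + ∑ i ∈ T, a i • v i) := by
    rw [hwy, add_comm, starProjection_add_starProjection_orthogonal]
  have hmem : w + ∑ i ∈ T, a i • v i ∈ U := hwy ▸ U.starProjection_apply_mem p
  have hresR : ∀ i ∈ T, ‖(R i)ᗮ.starProjection p‖ ^ 2 =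
      ‖e‖ ^ 2 + ‖a i‖ ^ 2 * ‖(R i)ᗮ.starProjection (v i)‖ ^ 2 := by
    intro i hi
    have hrest : w + ∑ j ∈ T.erase i, a j • v j ∈ R i :=
      add_mem (mem_sup_left hw) (mem_sup_right (sum_mem fun j hj =>
        smul_mem _ _ (subset_span ⟨j, hj, rfl⟩)))
    have hsplit : w + ∑ j ∈ T, a j • v j = (w + ∑ j ∈ T.erase i, a j • v j) + a i • v i := by
      rw [← Finset.sum_erase_add T _ hi, add_assoc]
    conv_lhs => rw [hdecomp]
    rw [norm_orthogonal_starProjection_add_sq (hRU i) he hmem, hsplit, map_add,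
      starProjection_orthogonal_apply_eq_zero hrest, zero_add, map_smul, norm_smul, mul_pow]
  have hresW : ‖Wᗮ.starProjection p‖ ^ 2 ≤
      ‖e‖ ^ 2 + (∑ i ∈ T, ‖a i‖) ^ 2 * ‖Wᗮ.starProjection p‖ ^ 2 := by
    conv_lhs => rw [hdecomp]
    rw [norm_orthogonal_starProjection_add_sq le_sup_left he hmem, map_add,
      starProjection_orthogonal_apply_eq_zero hw, zero_add, map_sum, ← mul_pow]
    gcongr
    rw [Finset.sum_mul]
    refine (norm_sum_le _ _).trans (Finset.sum_le_sum fun i hi => ?_)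
    rw [map_smul, norm_smul]
    exact mul_le_mul_of_nonneg_left (hp i hi) (norm_nonneg _)
  set d := ‖Wᗮ.starProjection p‖
  have hm : (1 : ℝ) ≤ T.card := by exact_mod_cast hT.card_pos
  have hterm : ∀ i ∈ T, (T.card : ℝ) ^ 2 * (‖e‖ ^ 2 + ‖a i‖ ^ 2 * d ^ 2) < d ^ 2 := by
    intro i hi
    have h1 := pow_lt_pow_left₀ (hlt i hi)
      (mul_nonneg (Nat.cast_nonneg _) (norm_nonneg _)) two_ne_zero
    rw [mul_pow, hresR i hi] at h1
    have h2 : ‖(R i)ᗮ.starProjection (v i)‖ ^ 2 ≤ d ^ 2 :=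
      pow_le_pow_left₀ (norm_nonneg _)
        ((norm_orthogonal_starProjection_anti le_sup_left _).trans (hp i hi)) 2
    set δ := ‖(R i)ᗮ.starProjection (v i)‖ ^ 2
    have hδ : 0 ≤ δ := sq_nonneg _
    have h3 : 0 ≤ (T.card : ℝ) ^ 2 * ‖e‖ ^ 2 := mul_nonneg (sq_nonneg _) (sq_nonneg _)
    have h4 : 0 < 1 - (T.card : ℝ) ^ 2 * ‖a i‖ ^ 2 := by
      by_contra! h
      nlinarith [mul_nonneg hδ (sub_nonneg.2 (sub_nonpos.1 h))]
    nlinarith [mul_le_mul_of_nonneg_left h2 h4.le]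
  have hsum := Finset.sum_lt_sum_of_nonempty hT hterm
  rw [← Finset.mul_sum, Finset.sum_add_distrib, ← Finset.sum_mul] at hsum
  simp only [Finset.sum_const, nsmul_eq_mul] at hsum
  have hcs := mul_le_mul_of_nonneg_right
    (sq_sum_le_card_mul_sum_sq (s := T) (f := fun i => ‖a i‖)) (sq_nonneg d)
  have hmain : (T.card : ℝ) ^ 2 * ‖e‖ ^ 2 + T.card * (∑ i ∈ T, ‖a i‖ ^ 2) * d ^ 2 < d ^ 2 := by
    refine lt_of_mul_lt_mul_left ?_ (zero_le_one.trans hm)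
    linarith
  nlinarith [mul_nonneg (sub_nonneg.2 (one_le_pow₀ hm : (1 : ℝ) ≤ (T.card : ℝ) ^ 2))
    (sq_nonneg ‖e‖)]

/-- Appending a vector to a family multiplies the Gram determinant by the squared distance of that
vector to the span of the family. -/
theorem det_gram_sumElim {κ : Type*} [Fintype κ] [DecidableEq κ] (v : κ → E) (p : E) :
    (gram 𝕜 (Sum.elim v fun _ : Unit => p)).det =
      (gram 𝕜 v).det * ((‖(span 𝕜 (Set.range v))ᗮ.starProjection p‖ ^ 2 : ℝ) : 𝕜) := by
  set K := span 𝕜 (Set.range v)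
  set q := Kᗮ.starProjection p
  have hvK (i : κ) : v i ∈ K := subset_span ⟨i, rfl⟩
  obtain ⟨c, hc⟩ := (mem_span_range_iff_exists_fun 𝕜).1 (K.starProjection_apply_mem p)
  have hp : p = ∑ i, c i • v i + q := by
    rw [hc, starProjection_add_starProjection_orthogonal]
  have hq : q ∈ Kᗮ := starProjection_apply_mem _ _
  have hvq (i : κ) : inner 𝕜 (v i) q = 0 := inner_right_of_mem_orthogonal (hvK i) hq
  have hqv (i : κ) : inner 𝕜 q (v i) = 0 := inner_left_of_mem_orthogonal (hvK i) hq
  clear_value q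
  let X : Matrix κ Unit 𝕜 := of fun i _ => c i
  have hfactor : gram 𝕜 (Sum.elim v fun _ : Unit => p) =
      fromBlocks 1 0 Xᴴ 1 * fromBlocks (gram 𝕜 v) 0 0 (of fun _ _ => ((‖q‖ ^ 2 : ℝ) : 𝕜)) *
        fromBlocks 1 X 0 1 := by
    rw [fromBlocks_multiply, fromBlocks_multiply]
    ext (i | i) (j | j)
    · simp [gram_apply]
    · simp [gram_apply, mul_apply, X, hp, inner_add_right, inner_sum, inner_smul_right, hvq,
        mul_comm]
    · simp [gram_apply, mul_apply, X, hp, inner_add_left, sum_inner, inner_smul_left, hqv]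
    · have hpp : inner 𝕜 p p =
          ∑ j, c j * ∑ i, starRingEnd 𝕜 (c i) * inner 𝕜 (v i) (v j) + (‖q‖ : 𝕜) ^ 2 := by
        rw [hp, inner_add_left, inner_add_right, inner_add_right, inner_self_eq_norm_sq_to_K q]
        simp only [sum_inner, inner_sum, inner_smul_left, inner_smul_right, hqv, hvq, mul_zero,
          Finset.sum_const_zero, add_zero, zero_add]
      rw [gram_apply, Sum.elim_inr, hpp]
      simp [gram_apply, mul_apply, X, mul_comm]
  rw [hfactor, det_mul, det_mul, det_fromBlocks_zero₁₂, det_fromBlocks_zero₁₂,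
    det_fromBlocks_zero₂₁]
  simp

end Projection

section Rows

variable {M n : ℕ} (A : Matrix (Fin M) (Fin n) ℂ)

/-- The `i`-th row of `A` as a Euclidean vector. -/
noncomputable def rowVec (i : Fin M) : EuclideanSpace ℂ (Fin n) := WithLp.toLp 2 (A i)

/-- The span of the rows of `A` indexed by `S`. -/
noncomputable def rowSpan (S : Finset (Fin M)) : Submodule ℂ (EuclideanSpace ℂ (Fin n)) :=
  Submodule.span ℂ (rowVec A '' S)

/-- The distance from the `i`-th row of `A` to the span of the rows indexed by `S`. -/
noncomputable def rowDist (S : Finset (Fin M)) (i : Fin M) : ℝ :=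
  ‖(rowSpan A S)ᗮ.starProjection (rowVec A i)‖

theorem det_rowsSub_mul_conjTranspose (S : Finset (Fin M)) :
    (rowsSub A S * (rowsSub A S)ᴴ).det = (gram ℂ fun i : S => rowVec A i).det := by
  rw [← det_transpose]
  rfl

theorem sqVol_insert {S : Finset (Fin M)} {j : Fin M} (hj : j ∉ S) :
    sqVol A (insert j S) = sqVol A S * rowDist A S j ^ 2 := by
  let φ := (Finset.subtypeInsertEquivOption hj).trans (Equiv.optionEquivSumPUnit.{0} _)
  have hφ : (gram ℂ fun i : {i // i ∈ insert j S} => rowVec A i) =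
      (gram ℂ (Sum.elim (fun i : S => rowVec A i) fun _ : Unit => rowVec A j)).submatrix φ φ := by
    have h (i : {i // i ∈ insert j S}) :
        rowVec A i = Sum.elim (fun i : S => rowVec A i) (fun _ : Unit => rowVec A j) (φ i) := by
      by_cases hi : (i : Fin M) = j <;> simp [φ, Finset.subtypeInsertEquivOption, hi]
    ext x y
    simp only [gram_apply, submatrix_apply, h]
  have hspan : Submodule.span ℂ (Set.range fun i : S => rowVec A i) = rowSpan A S := by
    rw [rowSpan, Set.image_eq_range]
    rfl
  rw [sqVol, sqVol, det_rowsSub_mul_conjTranspose, hφ, det_submatrix_equiv_self,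
    det_gram_sumElim, det_rowsSub_mul_conjTranspose, hspan]
  exact Complex.re_mul_ofReal _ _

theorem sqVol_nonneg (S : Finset (Fin M)) : 0 ≤ sqVol A S := by
  induction S using Finset.induction_on with
  | empty => simp [sqVol]
  | insert j S hj ih =>
    rw [sqVol_insert A hj]
    positivity

theorem sqVol_union_eq_zero {S : Finset (Fin M)} (hS : sqVol A S = 0) (T : Finset (Fin M)) :
    sqVol A (S ∪ T) = 0 := by
  induction T using Finset.induction_on with
  | empty => simpa
  | insert j T hj ih =>
    rw [Finset.union_insert]
    by_cases h : j ∈ S ∪ T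
    · rwa [Finset.insert_eq_of_mem h]
    · rw [sqVol_insert A h, ih, zero_mul]

/-- If `p` is a greedy choice for extending `S`, then some row of `T` can be exchanged for `p` at
the cost of a factor of at most `T.card ^ 2` in the squared volume of `S ∪ T`. -/
theorem exists_sqVol_union_le {S T : Finset (Fin M)} (hST : Disjoint S T) (hT : T.Nonempty)
    {p : Fin M} (hp : p ∉ S)
    (hmax : ∀ j ∉ S, sqVol A (insert j S) ≤ sqVol A (insert p S)) :
    ∃ i ∈ T, Disjoint (insert p S) (T.erase i) ∧
      sqVol A (S ∪ T) ≤ (T.card : ℝ) ^ 2 * sqVol A (insert p S ∪ T.erase i) := by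
  have hm : (1 : ℝ) ≤ (T.card : ℝ) ^ 2 := one_le_pow₀ (by exact_mod_cast hT.card_pos)
  by_cases hpT : p ∈ T
  · refine ⟨p, hpT, ?_, ?_⟩
    · simpa [Finset.disjoint_insert_left] using hST.mono_right (Finset.erase_subset p T)
    · rw [Finset.insert_union, ← Finset.union_insert, Finset.insert_erase hpT]
      exact le_mul_of_one_le_left (sqVol_nonneg A _) hm
  have hdisj (i : Fin M) : Disjoint (insert p S) (T.erase i) :=
    Finset.disjoint_insert_left.2 ⟨fun h => hpT (Finset.mem_of_mem_erase h),
      hST.mono_right (Finset.erase_subset i T)⟩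
  rcases (sqVol_nonneg A S).eq_or_lt with h0 | hpos
  · obtain ⟨i, hi⟩ := hT
    refine ⟨i, hi, hdisj i, ?_⟩
    rw [sqVol_union_eq_zero A h0.symm]
    exact mul_nonneg (sq_nonneg _) (sqVol_nonneg A _)
  obtain ⟨i, hi, hle⟩ := exists_norm_orthogonal_starProjection_le (rowSpan A S) hT (rowVec A)
    (rowVec A p) fun j hj => by
      have hjS : j ∉ S := fun h => Finset.disjoint_left.1 hST h hj
      have h := hmax j hjS
      rw [sqVol_insert A hjS, sqVol_insert A hp] at h
      exact le_of_sq_le_sq (le_of_mul_le_mul_left h hpos) (norm_nonneg _)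
  have hspan : rowSpan A S ⊔ Submodule.span ℂ (rowVec A '' (T.erase i)) =
      rowSpan A (S ∪ T.erase i) := by
    rw [rowSpan, rowSpan, ← Submodule.span_union, ← Set.image_union, ← Finset.coe_union]
  simp only [hspan] at hle
  have hiR : i ∉ S ∪ T.erase i := by
    simpa using fun h => Finset.disjoint_left.1 hST h hi
  have hpR : p ∉ S ∪ T.erase i := by
    simp [hp, hpT]
  refine ⟨i, hi, hdisj i, ?_⟩
  calc sqVol A (S ∪ T) = sqVol A (insert i (S ∪ T.erase i)) := by
        rw [← Finset.union_insert, Finset.insert_erase hi]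
    _ = sqVol A (S ∪ T.erase i) * rowDist A (S ∪ T.erase i) i ^ 2 := sqVol_insert A hiR
    _ ≤ sqVol A (S ∪ T.erase i) * (T.card * rowDist A (S ∪ T.erase i) p) ^ 2 :=
        mul_le_mul_of_nonneg_left (pow_le_pow_left₀ (norm_nonneg _) hle 2) (sqVol_nonneg A _)
    _ = (T.card : ℝ) ^ 2 * sqVol A (insert p S ∪ T.erase i) := by
        rw [Finset.insert_union, sqVol_insert A hpR]
        ring

end Rows

/-- Greedy row selection: if `∅ = S 0 ⊂ S 1 ⊂ ⋯ ⊂ S r` is a chain of row index sets with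
`|S k| = k` chosen greedily to maximize the squared volume at each step, then every set `T`
of `r` row indices satisfies `det(A_T (A_T)ᴴ) ≤ (r!)² · det(A_{S r} (A_{S r})ᴴ)`. -/
theorem statement3 (M n r : ℕ) (hr : r ≤ min M n)
    (A : Matrix (Fin M) (Fin n) ℂ)
    (S : ℕ → Finset (Fin M)) (hS0 : S 0 = ∅)
    (hcard : ∀ k ≤ r, (S k).card = k)
    (hstep : ∀ k < r, ∃ i ∉ S k, S (k + 1) = insert i (S k) ∧
      ∀ j ∉ S k, sqVol A (insert j (S k)) ≤ sqVol A (insert i (S k))) :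
    ∀ T : Finset (Fin M), T.card = r →
      sqVol A T ≤ ((Nat.factorial r : ℝ)) ^ 2 * sqVol A (S r) := by
  have key : ∀ m k, k + m = r → ∀ T : Finset (Fin M), Disjoint (S k) T → T.card = m →
      sqVol A (S k ∪ T) ≤ (m.factorial : ℝ) ^ 2 * sqVol A (S r) := by
    intro m
    induction m with
    | zero =>
      intro k hk T _ hT
      obtain rfl : k = r := hk
      rw [Finset.card_eq_zero.1 hT]
      simp
    | succ m ih =>
      intro k hk T hdisj hT
      obtain ⟨p, hp, hSk, hmax⟩ := hstep k (by omega)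
      obtain ⟨i, hi, hdisj', hle⟩ :=
        exists_sqVol_union_le A hdisj (Finset.card_pos.1 (by omega)) hp hmax
      rw [← hSk] at hdisj' hle
      have hrec := ih (k + 1) (by omega) (T.erase i) hdisj'
        (by simp [Finset.card_erase_of_mem hi, hT])
      calc sqVol A (S k ∪ T) ≤ (T.card : ℝ) ^ 2 * sqVol A (S (k + 1) ∪ T.erase i) := hle
        _ ≤ (T.card : ℝ) ^ 2 * ((m.factorial : ℝ) ^ 2 * sqVol A (S r)) := by gcongr
        _ = ((m + 1).factorial : ℝ) ^ 2 * sqVol A (S r) := by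
          rw [hT, Nat.factorial_succ]
          push_cast
          ring
  intro T hT
  simpa [hS0] using key r 0 (zero_add r) T (by simp [hS0]) hT
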